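/- arXiv:1411.2391 — 2 statements merged into one kernel-verified Lean document; each statement's English description precedes it below -/
import Mathlib

section
/- Let G be any real-valued random variable and let Z be a standard normal random variable. Then the Kolmogorov distance satisfies d_K(G, Z) ≤ 2 · √(d_bW(G, Z)). -/
open MeasureTheory ProbabilityTheory Real

/-- `h` is a test function for the bounded Wasserstein (Fortet–Mourier) distance:
`‖h‖_Lip + ‖h‖_∞ ≤ 1`. -/
def IsBWTestFun (h : ℝ → ℝ) : Prop :=
  ∃ a b : NNReal, (a : ℝ) + (b : ℝ) ≤ 1 ∧ LipschitzWith a h ∧ ∀ x, |h x| ≤ b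

/-- The bounded Wasserstein (Fortet–Mourier) distance between the laws of two
real-valued random variables `F, G` on `(Ω, P)`. -/
noncomputable def dBW {Ω : Type*} [MeasurableSpace Ω] (P : Measure Ω) (F G : Ω → ℝ) : ℝ :=
  sSup {d : ℝ | ∃ h : ℝ → ℝ, IsBWTestFun h ∧
    d = |(∫ ω, h (F ω) ∂P) - (∫ ω, h (G ω) ∂P)|}

/-- The Kolmogorov distance between the laws of two real-valued random variables. -/
noncomputable def dKol {Ω : Type*} [MeasurableSpace Ω] (P : Measure Ω) (F G : Ω → ℝ) : ℝ :=
  sSup {d : ℝ | ∃ x : ℝ,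
    d = |(P {ω | F ω ≤ x}).toReal - (P {ω | G ω ≤ x}).toReal|}


lemma dBW_bddAbove {Ω : Type*} [MeasurableSpace Ω] (P : Measure Ω) [IsProbabilityMeasure P]
    (F G : Ω → ℝ) : BddAbove {d : ℝ | ∃ h : ℝ → ℝ, IsBWTestFun h ∧
    d = |(∫ ω, h (F ω) ∂P) - (∫ ω, h (G ω) ∂P)|} := by
  refine ⟨2, ?_⟩
  rintro d ⟨h, ⟨a, b, hab, -, hb⟩, rfl⟩
  have hb1 : (b : ℝ) ≤ 1 := by have := a.2; linarith [a.coe_nonneg]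
  have key : ∀ X : Ω → ℝ, |∫ ω, h (X ω) ∂P| ≤ 1 := by
    intro X
    have := norm_integral_le_of_norm_le_const (μ := P) (f := fun ω => h (X ω)) (C := 1)
      (Filter.Eventually.of_forall fun ω => (hb (X ω)).trans hb1)
    simpa using this
  have h1 := abs_sub (∫ ω, h (F ω) ∂P) (∫ ω, h (G ω) ∂P)
  linarith [key F, key G]

lemma dBW_key {Ω : Type*} [MeasurableSpace Ω] (P : Measure Ω) [IsProbabilityMeasure P]
    (X Y : Ω → ℝ) (hX : Measurable X) (hY : Measurable Y) (D : ℝ)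
    (hD : ∀ h : ℝ → ℝ, IsBWTestFun h → (∫ ω, h (X ω) ∂P) - (∫ ω, h (Y ω) ∂P) ≤ D)
    (x e : ℝ) (he : 0 < e) :
    P.real {ω | X ω ≤ x} ≤ P.real {ω | Y ω ≤ x + e} + D / 2 + D / e := by
  obtain ⟨b, hb⟩ : ∃ b : ℝ, b = e / (e + 2) := ⟨_, rfl⟩
  obtain ⟨a, ha⟩ : ∃ a : ℝ, a = 2 / (e + 2) := ⟨_, rfl⟩
  have hb0 : 0 < b := by rw [hb]; positivity
  have ha0 : 0 < a := by rw [ha]; positivity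
  have hab : a + b = 1 := by rw [ha, hb]; field_simp; ring
  have hae : a * e = 2 * b := by rw [ha, hb]; field_simp
  let h : ℝ → ℝ := fun y => max (-b) (min b (a * (x - y) + b))
  have hlip : LipschitzWith ⟨a, ha0.le⟩ h := by
    refine LipschitzWith.const_max (LipschitzWith.const_min ?_ _) _
    refine LipschitzWith.of_dist_le_mul fun u v => ?_
    rw [Real.dist_eq, Real.dist_eq]
    have : a * (x - u) + b - (a * (x - v) + b) = a * (v - u) := by ring
    rw [this, abs_mul, abs_of_pos ha0, abs_sub_comm]
    rfl
  have hbd : ∀ y, |h y| ≤ b := fun y => abs_le.2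
    ⟨le_max_left _ _, max_le (by linarith) (min_le_left _ _)⟩
  have hcont : Continuous h := hlip.continuous
  have ht := hD h ⟨⟨a, ha0.le⟩, ⟨b, hb0.le⟩, hab.le, hlip, hbd⟩
  have hint : ∀ W : Ω → ℝ, Measurable W → Integrable (fun ω => h (W ω)) P := fun W hW =>
    Integrable.of_bound (hcont.measurable.comp hW).aestronglyMeasurable b
      (Filter.Eventually.of_forall fun ω => hbd (W ω))
  have hind : ∀ W : Ω → ℝ, Measurable W → ∀ t : ℝ,
      Integrable ({ω | W ω ≤ t}.indicator (fun _ => 2 * b)) P ∧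
      ∫ ω, ({ω | W ω ≤ t}.indicator (fun _ => 2 * b) ω - b) ∂P
        = 2 * b * P.real {ω | W ω ≤ t} - b := by
    intro W hW t
    have hm : MeasurableSet {ω | W ω ≤ t} := measurableSet_le hW measurable_const
    have hi : Integrable ({ω | W ω ≤ t}.indicator (fun _ => 2 * b)) P :=
      (integrable_const _).indicator hm
    refine ⟨hi, ?_⟩
    rw [integral_sub hi (integrable_const _), integral_indicator_const _ hm]
    simp [mul_comm]
  have h1 : 2 * b * P.real {ω | X ω ≤ x} - b ≤ ∫ ω, h (X ω) ∂P := by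
    rw [← (hind X hX x).2]
    refine integral_mono ((hind X hX x).1.sub (integrable_const _)) (hint X hX) fun ω => ?_
    by_cases hω : X ω ≤ x
    · have h3 : 0 ≤ a * (x - X ω) := mul_nonneg ha0.le (by linarith)
      have : b ≤ h (X ω) := le_max_of_le_right (le_min le_rfl (by linarith))
      simp [Set.indicator, hω]; linarith
    · have : -b ≤ h (X ω) := le_max_left _ _
      simp [Set.indicator, hω]; linarith
  have h2 : ∫ ω, h (Y ω) ∂P ≤ 2 * b * P.real {ω | Y ω ≤ x + e} - b := by
    rw [← (hind Y hY (x + e)).2]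
    refine integral_mono (hint Y hY) ((hind Y hY (x + e)).1.sub (integrable_const _)) fun ω => ?_
    by_cases hω : Y ω ≤ x + e
    · have := (abs_le.1 (hbd (Y ω))).2
      simp [Set.indicator, hω]; linarith
    · have h3 : a * (x - Y ω) ≤ a * (-e) := mul_le_mul_of_nonneg_left (by linarith) ha0.le
      have : h (Y ω) ≤ -b := max_le le_rfl (min_le_of_right_le (by linarith))
      simp [Set.indicator, hω]; linarith
  have h3 : 2 * b * (P.real {ω | X ω ≤ x} - P.real {ω | Y ω ≤ x + e}) ≤ D := by linarith
  have h4 : D / 2 + D / e = D / (2 * b) := by rw [hb]; field_simp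
  have h5 : P.real {ω | X ω ≤ x} - P.real {ω | Y ω ≤ x + e} ≤ D / (2 * b) := by
    rw [le_div_iff₀ (by positivity)]; linarith
  linarith

lemma gauss_conc {Ω : Type*} [MeasurableSpace Ω] (P : Measure Ω) [IsProbabilityMeasure P]
    (Z : Ω → ℝ) (hZ : Measurable Z) (hZlaw : Measure.map Z P = gaussianReal 0 1)
    (x e : ℝ) (he : 0 < e) :
    P.real {ω | Z ω ≤ x + e} ≤ P.real {ω | Z ω ≤ x} + e / 2 := by
  have hsub : {ω | Z ω ≤ x + e} ⊆ {ω | Z ω ≤ x} ∪ Z ⁻¹' (Set.Ioc x (x + e)) := by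
    intro ω hω
    by_cases h : Z ω ≤ x
    · exact Or.inl h
    · exact Or.inr ⟨not_le.1 h, hω⟩
  have h1 : P (Z ⁻¹' (Set.Ioc x (x + e))) ≤ ENNReal.ofReal (e / 2) := by
    rw [← Measure.map_apply hZ measurableSet_Ioc, hZlaw, gaussianReal_apply _ one_ne_zero]
    calc ∫⁻ t in Set.Ioc x (x + e), gaussianPDF 0 1 t
        ≤ ∫⁻ t in Set.Ioc x (x + e), ENNReal.ofReal (1 / 2) := by
          refine lintegral_mono fun t => ENNReal.ofReal_le_ofReal ?_
          rw [gaussianPDFReal]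
          have hs : (2 : ℝ) ≤ √(2 * π * ((1 : NNReal) : ℝ)) := by
            apply Real.le_sqrt_of_sq_le
            have := Real.pi_gt_three
            simp; linarith
          have hi : (√(2 * π * ((1 : NNReal) : ℝ)))⁻¹ ≤ 1 / 2 := by
            rw [one_div]; exact inv_anti₀ (by norm_num) hs
          have hexp : rexp (-(t - 0) ^ 2 / (2 * ((1 : NNReal) : ℝ))) ≤ 1 := by
            rw [Real.exp_le_one_iff]
            have := sq_nonneg (t - 0)
            simp only [NNReal.coe_one]
            linarith
          calc _ ≤ (1 / 2 : ℝ) * 1 := mul_le_mul hi hexp (Real.exp_nonneg _) (by norm_num)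
            _ = 1 / 2 := mul_one _
      _ = ENNReal.ofReal (e / 2) := by
          rw [setLIntegral_const, Real.volume_Ioc, ← ENNReal.ofReal_mul (by norm_num)]
          congr 1; ring
  have h2 : P.real (Z ⁻¹' (Set.Ioc x (x + e))) ≤ e / 2 :=
    ENNReal.toReal_le_of_le_ofReal (by positivity) h1
  calc _ ≤ P.real ({ω | Z ω ≤ x} ∪ Z ⁻¹' (Set.Ioc x (x + e))) := measureReal_mono hsub
    _ ≤ _ := measureReal_union_le _ _
    _ ≤ _ := by linarith

/-- Proposition 2.1: for any real-valued random variable `G` and `Z ~ N(0,1)`,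
`d_K(G, Z) ≤ 2 √(d_bW(G, Z))`. -/
theorem dKol_le_two_sqrt_dBW
    {Ω : Type*} [MeasurableSpace Ω] (P : Measure Ω) [IsProbabilityMeasure P]
    (G Z : Ω → ℝ) (hG : Measurable G) (hZ : Measurable Z)
    (hZlaw : Measure.map Z P = gaussianReal 0 1) :
    dKol P G Z ≤ 2 * Real.sqrt (dBW P G Z) := by
  have habs : ∀ h : ℝ → ℝ, IsBWTestFun h →
      |(∫ ω, h (G ω) ∂P) - (∫ ω, h (Z ω) ∂P)| ≤ dBW P G Z :=
    fun h hh => le_csSup (dBW_bddAbove P G Z) ⟨h, hh, rfl⟩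
  have hD0 : 0 ≤ dBW P G Z := by
    apply Real.sSup_nonneg
    rintro d ⟨h, -, rfl⟩
    exact abs_nonneg _
  refine Real.sSup_le ?_ (by positivity)
  rintro d ⟨x, rfl⟩
  change |P.real {ω | G ω ≤ x} - P.real {ω | Z ω ≤ x}| ≤ _
  generalize dBW P G Z = D at *
  have main : ∀ e : ℝ, 0 < e →
      |P.real {ω | G ω ≤ x} - P.real {ω | Z ω ≤ x}| ≤ D / 2 + D / e + e / 2 := by
    intro e he
    have k1 := dBW_key P G Z hG hZ D (fun h hh => (abs_le.1 (habs h hh)).2) x e he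
    have k2 := dBW_key P Z G hZ hG D
      (fun h hh => by linarith [(abs_le.1 (habs h hh)).1]) (x - e) e he
    have g1 := gauss_conc P Z hZ hZlaw x e he
    have g2 := gauss_conc P Z hZ hZlaw (x - e) e he
    rw [sub_add_cancel] at k2 g2
    rw [abs_le]
    constructor <;> linarith
  have hone : |P.real {ω | G ω ≤ x} - P.real {ω | Z ω ≤ x}| ≤ 1 := by
    have a1 := measureReal_nonneg (μ := P) (s := {ω | G ω ≤ x})
    have a2 := measureReal_nonneg (μ := P) (s := {ω | Z ω ≤ x})
    have a3 := measureReal_le_one (μ := P) (s := {ω | G ω ≤ x})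
    have a4 := measureReal_le_one (μ := P) (s := {ω | Z ω ≤ x})
    rw [abs_le]
    constructor <;> linarith
  rcases hD0.eq_or_lt with h0 | hpos
  · subst h0
    simp only [Real.sqrt_zero, mul_zero]
    refine le_of_forall_pos_le_add fun e he => ?_
    have := main e he
    simp only [zero_div] at this
    linarith
  · have hs : 0 < √D := Real.sqrt_pos.2 hpos
    have hsq : √D * √D = D := Real.mul_self_sqrt hD0
    have hm := main (√D) hs
    rw [Real.div_sqrt] at hm
    by_cases hc : √D ≤ 1 / 2
    · nlinarith
    · linarith
end

section
/- Let G be a real-valued random variable and Z a standard normal random variable, and suppose B_K ≥ 0 is such that |P(G ≤ y) − P(Z ≤ y)| ≤ B_K for all y ∈ ℝ. Let 0 < α < 1 be such that 0 < α/2 − B_K and 1 − α/2 + B_K < 1. Then P( Φ^{-1}(α/2 − B_K) ≤ G ≤ Φ^{-1}(1 − α/2 + B_K) ) ≥ 1 − α, where Φ^{-1} denotes the quantile function of the standard normal distribution. -/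
open MeasureTheory ProbabilityTheory Real

/-- Conservative confidence bounds from a Kolmogorov-distance bound (Section 2.1):
if `|P(G ≤ y) − Φ(y)| ≤ B_K` for all `y`, where `Φ` is the standard normal c.d.f.
with quantile function `Q`, and `0 < α/2 − B_K` and `1 − α/2 + B_K < 1`, then
`P(Q(α/2 − B_K) ≤ G ≤ Q(1 − α/2 + B_K)) ≥ 1 − α`. -/
theorem conservative_confidence_interval
    {Ω : Type*} [MeasurableSpace Ω] (P : Measure Ω) [IsProbabilityMeasure P]
    (G Z : Ω → ℝ) (hG : Measurable G) (hZ : Measurable Z)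
    (hZlaw : Measure.map Z P = gaussianReal 0 1)
    (Q : ℝ → ℝ)
    (hQ : ∀ p : ℝ, 0 < p → p < 1 → gaussianReal 0 1 (Set.Iic (Q p)) = ENNReal.ofReal p)
    (BK : ℝ) (hBK : 0 ≤ BK)
    (hbound : ∀ y : ℝ, |(P {ω | G ω ≤ y}).toReal - (P {ω | Z ω ≤ y}).toReal| ≤ BK)
    (α : ℝ) (hα0 : 0 < α) (hα1 : α < 1)
    (hlo : 0 < α / 2 - BK) (hhi : 1 - α / 2 + BK < 1) :
    ENNReal.ofReal (1 - α) ≤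
      P {ω | Q (α / 2 - BK) ≤ G ω ∧ G ω ≤ Q (1 - α / 2 + BK)} := by
  have hZr : ∀ p : ℝ, 0 < p → p < 1 → (P {ω | Z ω ≤ Q p}).toReal = p := by
    intro p h0 h1
    have h := hQ p h0 h1
    rw [← hZlaw, Measure.map_apply hZ measurableSet_Iic] at h
    have h2 : P {ω | Z ω ≤ Q p} = ENNReal.ofReal p := h
    rw [h2, ENNReal.toReal_ofReal h0.le]
  have ha := (abs_le.mp (hbound (Q (α / 2 - BK)))).2
  have hb := (abs_le.mp (hbound (Q (1 - α / 2 + BK)))).1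
  rw [hZr _ hlo (by linarith)] at ha
  rw [hZr _ (by linarith) hhi] at hb
  have hsub : {ω | G ω ≤ Q (1 - α / 2 + BK)} ⊆
      {ω | Q (α / 2 - BK) ≤ G ω ∧ G ω ≤ Q (1 - α / 2 + BK)} ∪ {ω | G ω ≤ Q (α / 2 - BK)} := by
    intro ω hω
    rcases le_total (Q (α / 2 - BK)) (G ω) with h | h
    · exact Or.inl ⟨h, hω⟩
    · exact Or.inr h
  have hle := (measure_mono (μ := P) hsub).trans (measure_union_le _ _)
  have hr := ENNReal.toReal_mono (by finiteness) hle
  rw [ENNReal.toReal_add (by finiteness) (by finiteness)] at hr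
  apply ENNReal.ofReal_le_of_le_toReal
  linarith
end
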